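/- The min-max and max-min values of g coincide: min over p ∈ [0,1] of (sup over positive integers d of g(p,d)) equals sup over positive integers d of (min over p ∈ [0,1] of g(p,d)), and both equal g(p*,3) = α_alg ≈ 1.546, with the min-max attained at p = p* and d = 3. -/

import Mathlib

noncomputable def g (p : ℝ) (d : ℕ) : ℝ :=
  1 + (1 - (1 - p) / (d : ℝ)) ^ d + ((1 - p) * (1 - 1 / (d : ℝ))) ^ d

noncomputable def pstar : ℝ := (10 - 6 * Real.sqrt 2) / 7

noncomputable def alphaAlg : ℝ := g pstar 3

lemma g_nonneg {p : ℝ} (hp : p ∈ Set.Icc (0 : ℝ) 1) {d : ℕ} (hd : 0 < d) : 0 ≤ g p d := by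
  obtain ⟨h0, h1⟩ := hp
  have hd' : (1 : ℝ) ≤ d := by exact_mod_cast hd
  have a1 : 0 ≤ 1 - (1 - p) / (d : ℝ) := by
    rw [sub_nonneg, div_le_one (by linarith)]; linarith
  have a2 : 0 ≤ 1 - 1 / (d : ℝ) := by
    rw [sub_nonneg, div_le_one (by linarith)]; linarith
  have a3 : 0 ≤ 1 - p := by linarith
  unfold g
  positivity

lemma g_le_three {p : ℝ} (hp : p ∈ Set.Icc (0 : ℝ) 1) {d : ℕ} (hd : 0 < d) : g p d ≤ 3 := by
  obtain ⟨h0, h1⟩ := hp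
  have hd' : (1 : ℝ) ≤ d := by exact_mod_cast hd
  have a1 : 0 ≤ 1 - (1 - p) / (d : ℝ) := by
    rw [sub_nonneg, div_le_one (by linarith)]; linarith
  have a2 : 0 ≤ 1 - 1 / (d : ℝ) := by
    rw [sub_nonneg, div_le_one (by linarith)]; linarith
  have a3 : 0 ≤ 1 - p := by linarith
  have b1 : 0 ≤ (1 - p) / (d : ℝ) := by positivity
  have b2 : 0 ≤ 1 / (d : ℝ) := by positivity
  have c1 : (1 - (1 - p) / (d : ℝ)) ^ d ≤ 1 := pow_le_one₀ a1 (by linarith)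
  have c2 : ((1 - p) * (1 - 1 / (d : ℝ))) ^ d ≤ 1 :=
    pow_le_one₀ (by positivity) (mul_le_one₀ (by linarith) a2 (by linarith))
  unfold g
  linarith

lemma one_sub_pstar_bounds : 0.7836 ≤ 1 - pstar ∧ 1 - pstar ≤ 0.7837 := by
  have h1 : (1.4142 : ℝ) ≤ Real.sqrt 2 := Real.le_sqrt_of_sq_le (by norm_num)
  have h2 : Real.sqrt 2 ≤ 1.41422 := Real.sqrt_le_iff.2 (by norm_num)
  unfold pstar
  constructor <;> linarith

lemma one_sub_pstar_quadratic : 7 * (1 - pstar) ^ 2 + 6 * (1 - pstar) - 9 = 0 := by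
  have h : Real.sqrt 2 ^ 2 = 2 := Real.sq_sqrt (by norm_num)
  unfold pstar
  linear_combination (36 / 7) * h

lemma pstar_mem_Icc : pstar ∈ Set.Icc (0 : ℝ) 1 := by
  obtain ⟨h1, h2⟩ := one_sub_pstar_bounds
  constructor <;> linarith

lemma alphaAlg_le_g_three {p : ℝ} (hp : p ∈ Set.Icc (0 : ℝ) 1) : alphaAlg ≤ g p 3 := by
  obtain ⟨h1, -⟩ := one_sub_pstar_bounds
  have hq := one_sub_pstar_quadratic
  have hp' : 0 ≤ 1 - p := by linarith [hp.2]
  -- The difference of values has a double root at `pstar`.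
  have key : g p 3 - alphaAlg =
      (p - pstar) ^ 2 * (1 / 3 + 7 / 27 * ((1 - p) + 2 * (1 - pstar))) := by
    unfold alphaAlg g
    push_cast
    linear_combination (pstar - p) / 9 * hq
  have : 0 ≤ g p 3 - alphaAlg := by
    rw [key]
    have : 0 ≤ 1 - pstar := by linarith
    positivity
  linarith

lemma lt_alphaAlg : 1.5455 < alphaAlg := by
  obtain ⟨h1, h2⟩ := one_sub_pstar_bounds
  have a : (1 - 0.7837 / 3 : ℝ) ^ 3 ≤ (1 - (1 - pstar) / 3) ^ 3 :=
    pow_le_pow_left₀ (by norm_num) (by linarith) 3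
  have b : (0.7836 * (1 - 1 / 3) : ℝ) ^ 3 ≤ ((1 - pstar) * (1 - 1 / 3)) ^ 3 :=
    pow_le_pow_left₀ (by norm_num) (by linarith) 3
  unfold alphaAlg g
  push_cast
  norm_num at a b ⊢
  linarith

lemma g_pstar_le {d : ℕ} (hd : 0 < d) :
    g pstar d ≤ 1 + (1 - 0.7836 / (d : ℝ)) ^ d + (0.7837 * (1 - 1 / (d : ℝ))) ^ d := by
  obtain ⟨h1, h2⟩ := one_sub_pstar_bounds
  have hd' : (1 : ℝ) ≤ d := by exact_mod_cast hd
  have a1 : 0 ≤ 1 - (1 - pstar) / (d : ℝ) := by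
    rw [sub_nonneg, div_le_one (by linarith)]; linarith
  have a2 : 0 ≤ 1 - 1 / (d : ℝ) := by
    rw [sub_nonneg, div_le_one (by linarith)]; linarith
  have a3 : 0 ≤ 1 - pstar := by linarith
  unfold g
  gcongr

lemma exp_neg_lt : Real.exp (-0.7836) < 0.4575 := by
  have h := Real.sum_le_exp_of_nonneg (x := 0.7836) (by norm_num) 6
  rw [Real.exp_neg, inv_lt_comm₀ (Real.exp_pos _) (by norm_num)]
  refine lt_of_lt_of_le ?_ h
  norm_num [Finset.sum_range_succ, Nat.factorial]

lemma g_pstar_le_alphaAlg_of_six_le {d : ℕ} (hd : 6 ≤ d) : g pstar d ≤ alphaAlg := by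
  have hd' : (6 : ℝ) ≤ d := by exact_mod_cast hd
  have h1 : (1 - 0.7836 / (d : ℝ)) ^ d ≤ Real.exp (-0.7836) :=
    Real.one_sub_div_pow_le_exp_neg (by linarith)
  have h2 : (1 - 1 / (d : ℝ)) ^ d ≤ Real.exp (-1) :=
    Real.one_sub_div_pow_le_exp_neg (by linarith)
  have h3 : (0.7837 : ℝ) ^ d ≤ 0.7837 ^ 6 :=
    pow_le_pow_of_le_one (by norm_num) (by norm_num) hd
  have h4 : Real.exp (-1) < 0.368 := by
    rw [Real.exp_neg, inv_lt_comm₀ (Real.exp_pos _) (by norm_num)]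
    refine lt_trans ?_ Real.exp_one_gt_d9
    norm_num
  have h5 : (0.7837 * (1 - 1 / (d : ℝ))) ^ d ≤ 0.7837 ^ 6 * 0.368 := by
    rw [mul_pow]
    have a2 : 0 ≤ 1 - 1 / (d : ℝ) := by
      rw [sub_nonneg, div_le_one (by linarith)]; linarith
    exact mul_le_mul h3 (h2.trans h4.le) (by positivity) (by positivity)
  have h6 := g_pstar_le (d := d) (by omega)
  have h7 := exp_neg_lt
  have h8 := lt_alphaAlg
  norm_num at *
  linarith

lemma g_pstar_le_alphaAlg {d : ℕ} (hd : 0 < d) : g pstar d ≤ alphaAlg := by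
  rcases le_or_gt 6 d with h | h
  · exact g_pstar_le_alphaAlg_of_six_le h
  · by_cases h3 : d = 3
    · subst h3; exact le_rfl
    · refine (g_pstar_le hd).trans (le_trans ?_ lt_alphaAlg.le)
      interval_cases d <;> first | exact absurd rfl h3 | norm_num

theorem minmax_eq_maxmin :
    sInf {y : ℝ | ∃ p ∈ Set.Icc (0 : ℝ) 1,
        y = sSup {x : ℝ | ∃ d : ℕ, 0 < d ∧ x = g p d}} = alphaAlg ∧
    sSup {y : ℝ | ∃ d : ℕ, 0 < d ∧
        y = sInf {x : ℝ | ∃ p ∈ Set.Icc (0 : ℝ) 1, x = g p d}} = alphaAlg ∧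
    sSup {x : ℝ | ∃ d : ℕ, 0 < d ∧ x = g pstar d} = alphaAlg := by
  have hsup : sSup {x : ℝ | ∃ d : ℕ, 0 < d ∧ x = g pstar d} = alphaAlg := by
    refine IsGreatest.csSup_eq ⟨⟨3, by norm_num, rfl⟩, ?_⟩
    rintro _ ⟨d, hd, rfl⟩
    exact g_pstar_le_alphaAlg hd
  have hinf : sInf {x : ℝ | ∃ p ∈ Set.Icc (0 : ℝ) 1, x = g p 3} = alphaAlg := by
    refine IsLeast.csInf_eq ⟨⟨pstar, pstar_mem_Icc, rfl⟩, ?_⟩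
    rintro _ ⟨p, hp, rfl⟩
    exact alphaAlg_le_g_three hp
  refine ⟨IsLeast.csInf_eq ⟨⟨pstar, pstar_mem_Icc, hsup.symm⟩, ?_⟩,
    IsGreatest.csSup_eq ⟨⟨3, by norm_num, hinf.symm⟩, ?_⟩, hsup⟩
  · rintro _ ⟨p, hp, rfl⟩
    refine (alphaAlg_le_g_three hp).trans (le_csSup ⟨3, ?_⟩ ⟨3, by norm_num, rfl⟩)
    rintro _ ⟨d, hd, rfl⟩
    exact g_le_three hp hd
  · rintro _ ⟨d, hd, rfl⟩
    refine le_trans (csInf_le ⟨0, ?_⟩ ⟨pstar, pstar_mem_Icc, rfl⟩) (g_pstar_le_alphaAlg hd)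
    rintro _ ⟨p, hp, rfl⟩
    exact g_nonneg hp hd
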